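/- Let w̃ ∈ FC(C̃_n) and H := H(w̃). The heap 𝔑(H) produced by the reduction algorithm and the integer del(H) do not depend on the order in which the forks are eliminated. Moreover 𝔑(H) = H(τ(w̃)) and del(H) = α(w̃). -/

import Mathlib

namespace BCF
open List

/-! ### Coxeter matrices of types `A_{n+1}` and `C̃_n`.

Generators are indexed by `Fin (n+1)`, with index `i` corresponding to the
generator `s_{i+1}` (resp. `s̃_{i+1}`) of the paper. -/

/-- Entries of the Coxeter matrix of affine type `C̃ₙ` (on indices `0, …, n`). -/
def cval (n a b : ℕ) : ℕ :=
  if a = b then 1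
  else if max a b = min a b + 1 then (if min a b = 0 ∨ max a b = n then 4 else 3)
  else 2

/-- Entries of the Coxeter matrix of type `A_{n+1}` (on indices `0, …, n`). -/
def aval (a b : ℕ) : ℕ :=
  if a = b then 1 else if max a b = min a b + 1 then 3 else 2

lemma cval_symm (n a b : ℕ) : cval n a b = cval n b a := by
  unfold cval
  rcases eq_or_ne a b with h | h
  · simp [h]
  · rw [if_neg h, if_neg (Ne.symm h), Nat.max_comm b a, Nat.min_comm b a]

lemma aval_symm (a b : ℕ) : aval a b = aval b a := by
  unfold aval
  rcases eq_or_ne a b with h | h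
  · simp [h]
  · rw [if_neg h, if_neg (Ne.symm h), Nat.max_comm b a, Nat.min_comm b a]

lemma cval_ne_one (n a b : ℕ) (h : a ≠ b) : cval n a b ≠ 1 := by
  unfold cval
  rw [if_neg h]
  split <;> [skip; omega]
  split <;> omega

lemma aval_ne_one (a b : ℕ) (h : a ≠ b) : aval a b ≠ 1 := by
  unfold aval
  rw [if_neg h]
  split <;> omega

/-- The Coxeter matrix of type `C̃ₙ` on the generator set `{s̃₁, …, s̃ₙ₊₁}`. -/
def CMat (n : ℕ) : CoxeterMatrix (Fin (n + 1)) where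
  M := Matrix.of fun i j => cval n i.val j.val
  isSymm := by
    unfold Matrix.IsSymm
    ext i j
    exact cval_symm n j i
  diagonal i := by simp [cval]
  off_diagonal i j h := cval_ne_one n i j (fun hc => h (Fin.ext hc))

/-- The Coxeter matrix of type `A_{n+1}` on the generator set `{s₁, …, sₙ₊₁}`. -/
def AMat (n : ℕ) : CoxeterMatrix (Fin (n + 1)) where
  M := Matrix.of fun i j => aval i.val j.val
  isSymm := by
    unfold Matrix.IsSymm
    ext i j
    exact aval_symm j i
  diagonal i := by simp [aval]
  off_diagonal i j h := aval_ne_one i j (fun hc => h (Fin.ext hc))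

/-- The Coxeter group of type `C̃ₙ`. -/
abbrev WC (n : ℕ) : Type := (CMat n).Group

/-- The Coxeter group of type `A_{n+1}`. -/
abbrev WA (n : ℕ) : Type := (AMat n).Group

/-- The Coxeter system of type `C̃ₙ`. -/
def csC (n : ℕ) : CoxeterSystem (CMat n) (WC n) := (CMat n).toCoxeterSystem

/-- The Coxeter system of type `A_{n+1}`. -/
def csA (n : ℕ) : CoxeterSystem (AMat n) (WA n) := (AMat n).toCoxeterSystem

/-! ### Commutation moves and fully commutative elements -/

/-- One commutation move: swap two adjacent commuting letters. -/
def CommMove {B : Type*} (Mx : CoxeterMatrix B) (l l' : List B) : Prop :=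
  ∃ (u v : List B) (i j : B), Mx.M i j = 2 ∧ l = u ++ i :: j :: v ∧ l' = u ++ j :: i :: v

/-- Two words are in the same commutation class. -/
def CommEquiv {B : Type*} (Mx : CoxeterMatrix B) : List B → List B → Prop :=
  Relation.ReflTransGen (CommMove Mx)

/-- An element of a Coxeter group is *fully commutative* (FC) if any reduced
expression for it can be obtained from any other by commutation moves only. -/
def IsFC {B : Type*} {W : Type*} [Group W] {Mx : CoxeterMatrix B}
    (cs : CoxeterSystem Mx W) (w : W) : Prop :=
  ∀ l l' : List B, cs.IsReduced l → cs.wordProd l = w →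
    cs.IsReduced l' → cs.wordProd l' = w → CommEquiv Mx l l'

/-! ### The Temperley–Lieb algebra of type `A_{n+1}` -/

noncomputable section

/-- The defining relations of the Temperley–Lieb algebra `TL(A_{n+1})`
over `ℤ[δ]`: (a1) `bᵢ² = δ bᵢ`; (a2) `bᵢbⱼ = bⱼbᵢ` for `|i-j| > 1`;
(a3) `bᵢbⱼbᵢ = bᵢ` for `|i-j| = 1`. -/
inductive TLRel (n : ℕ) :
    FreeAlgebra (Polynomial ℤ) (Fin (n + 1)) → FreeAlgebra (Polynomial ℤ) (Fin (n + 1)) → Prop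
  | sq (i : Fin (n + 1)) :
      TLRel n (FreeAlgebra.ι (Polynomial ℤ) i * FreeAlgebra.ι (Polynomial ℤ) i)
        ((Polynomial.X : Polynomial ℤ) • FreeAlgebra.ι (Polynomial ℤ) i)
  | comm (i j : Fin (n + 1)) (h : aval i.val j.val = 2) :
      TLRel n (FreeAlgebra.ι (Polynomial ℤ) i * FreeAlgebra.ι (Polynomial ℤ) j)
        (FreeAlgebra.ι (Polynomial ℤ) j * FreeAlgebra.ι (Polynomial ℤ) i)
  | braid (i j : Fin (n + 1)) (h : aval i.val j.val = 3) :
      TLRel n (FreeAlgebra.ι (Polynomial ℤ) i * FreeAlgebra.ι (Polynomial ℤ) j *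
          FreeAlgebra.ι (Polynomial ℤ) i)
        (FreeAlgebra.ι (Polynomial ℤ) i)

/-- The Temperley–Lieb algebra `TL(A_{n+1})` as a quotient of the free
`ℤ[δ]`-algebra on the generators `b₁, …, b_{n+1}`. -/
abbrev TLA (n : ℕ) : Type := RingQuot (TLRel n)

/-- The generator `b_{i+1}` of `TL(A_{n+1})`. -/
def tlGen (n : ℕ) (i : Fin (n + 1)) : TLA n :=
  RingQuot.mkAlgHom (Polynomial ℤ) (TLRel n) (FreeAlgebra.ι (Polynomial ℤ) i)

/-- The product `b_{i₁} ⋯ b_{i_k}` in `TL(A_{n+1})` associated with a word. -/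
def bProd (n : ℕ) (l : List (Fin (n + 1))) : TLA n := (l.map (tlGen n)).prod

/-- The element `δ` of `TL(A_{n+1})`. -/
def tlδ (n : ℕ) : TLA n := algebraMap (Polynomial ℤ) (TLA n) Polynomial.X

end

end BCF

namespace BCF

/-! ### The reduction algorithm on heaps.

Heaps of fully commutative elements are identified with the commutation classes of
their reduced words.  A *fork* of a heap is then a (commutation-class) occurrence of
a factor `s_i s_{i±1} s_i`, and step (F3) of fork elimination corresponds to merging
an occurrence of a factor `s_j s_j` while increasing the counter `del` by one. -/

/-- Two generator indices are adjacent (the corresponding generators do not commute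
and are distinct). -/
def adjIdx {n : ℕ} (i j : Fin (n + 1)) : Prop := i.val + 1 = j.val ∨ j.val + 1 = i.val

/-- One step of the reduction algorithm, acting on a word together with the
counter `del` of (F3)-identifications: a commutation move, the elimination of a
fork `s_i s_{i±1} s_i ↦ s_i` (steps (F1)-(F2)), or the identification of two
consecutive unconnected nodes in the same column `s_i s_i ↦ s_i` (step (F3)). -/
inductive RStep (n : ℕ) : List (Fin (n + 1)) × ℕ → List (Fin (n + 1)) × ℕ → Prop
  | comm {l l' : List (Fin (n + 1))} {c : ℕ} (h : CommMove (CMat n) l l') :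
      RStep n (l, c) (l', c)
  | fork (u v : List (Fin (n + 1))) (i j : Fin (n + 1)) (c : ℕ) (h : adjIdx i j) :
      RStep n (u ++ i :: j :: i :: v, c) (u ++ i :: v, c)
  | merge (u v : List (Fin (n + 1))) (i : Fin (n + 1)) (c : ℕ) :
      RStep n (u ++ i :: i :: v, c) (u ++ i :: v, c + 1)

/-- A word whose heap contains no fork and no repeated column-adjacent pair:
no further reduction steps are possible.  (Such a heap is an alternating heap of
type `A_{n+1}`.) -/
def NoForkWord (n : ℕ) (l : List (Fin (n + 1))) : Prop :=
  ∀ l' : List (Fin (n + 1)), CommEquiv (CMat n) l l' →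
    (¬ ∃ (u v : List (Fin (n + 1))) (i j : Fin (n + 1)),
        adjIdx i j ∧ l' = u ++ i :: j :: i :: v) ∧
    (¬ ∃ (u v : List (Fin (n + 1))) (i : Fin (n + 1)), l' = u ++ i :: i :: v)

end BCF

namespace BCF

section
variable {P : Type} [DecidableEq P]
def eA (a b : P) (s : P → P) : P → P := fun p =>
  if p = a then b else if p = b then a else if s p = a then s b else if s p = b then s a else s p
def Good (s : P → P) : Prop := (∀ p, s (s p) = p) ∧ ∀ p, s p ≠ p
def ep (a b : P) (s : P → P) : ℕ := if s a = b then 1 else 0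
lemma eA_good (a b : P) (hab : a ≠ b) (s : P → P) (h : Good s) : Good (eA a b s) := by
  obtain ⟨h1, h2⟩ := h
  refine ⟨fun p => ?_, fun p => ?_⟩
  · have := h1 p; have := h1 a; have := h1 b
    unfold eA; grind
  · have := h1 p; have := h1 a; have := h1 b; have := h2 p
    unfold eA; grind
lemma eA_symm (a b : P) (s : P → P) : eA a b s = eA b a s := by
  funext p; unfold eA; grind
lemma eA_idem (a b : P) (s : P → P) : eA a b (eA a b s) = eA a b s := by
  funext p; unfold eA; grind
lemma ep_idem (a b : P) (s : P → P) : ep a b (eA a b s) = 1 := by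
  simp [ep, eA]
lemma eA_comm (a b c d : P) (s : P → P) (h : Good s) (hab : a ≠ b) (hcd : c ≠ d) (hac : a ≠ c) (had : a ≠ d)
    (hbc : b ≠ c) (hbd : b ≠ d) : eA a b (eA c d s) = eA c d (eA a b s) := by
  obtain ⟨h1, h2⟩ := h
  funext p
  have := h1 p; have := h1 a; have := h1 b; have := h1 c; have := h1 d
  unfold eA; grind (splits := 40)
lemma ep_comm (a b c d : P) (s : P → P) (h : Good s) (hab : a ≠ b) (hcd : c ≠ d) (hac : a ≠ c) (had : a ≠ d)
    (hbc : b ≠ c) (hbd : b ≠ d) : ep c d s + ep a b (eA c d s) = ep a b s + ep c d (eA a b s) := by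
  obtain ⟨h1, h2⟩ := h
  have := h1 a; have := h1 b; have := h1 c; have := h1 d
  unfold ep eA; grind
lemma eA_braid (a b c : P) (s : P → P) (h : Good s) (hab : a ≠ b) (hac : a ≠ c)
    (hbc : b ≠ c) : eA a b (eA b c (eA a b s)) = eA a b s := by
  obtain ⟨h1, h2⟩ := eA_good a b hab s h
  have ha : eA a b s a = b := by simp [eA]
  have hb : eA a b s b = a := by have := h1 a; rwa [ha] at this
  generalize eA a b s = s at *
  funext p
  have := h1 p; have := h1 a; have := h1 b; have := h1 c
  unfold eA; grind
lemma ep_braid (a b c : P) (s : P → P) (h : Good s) (hab : a ≠ b) (hac : a ≠ c)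
    (hbc : b ≠ c) : ep b c (eA a b s) = 0 ∧ ep a b (eA b c (eA a b s)) = 0 := by
  obtain ⟨h1, h2⟩ := eA_good a b hab s h
  have ha : eA a b s a = b := by simp [eA]
  have hb : eA a b s b = a := by have := h1 a; rwa [ha] at this
  generalize eA a b s = s at *
  have := h1 a; have := h1 b; have := h1 c
  unfold ep eA; grind
end
section
variable {n : ℕ}

def pr (p : ℕ) (w : List (Fin (n + 1))) : List (Fin (n + 1)) :=
  w.filter (fun x => decide (x.val + 1 = p ∨ x.val = p))

def Alt (w : List (Fin (n + 1))) : Prop := ∀ p, (pr p w).IsChain (· ≠ ·)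

def act : List (Fin (n + 1)) → (ℕ × Bool → ℕ × Bool)
  | [] => fun p => (p.1, !p.2)
  | i :: u => eA (i.val, true) (i.val + 1, true) (act u)

lemma act_good (w : List (Fin (n + 1))) : Good (act w) := by
  induction w with
  | nil => refine ⟨fun p => ?_, fun p => ?_⟩ <;> rcases p with ⟨x, b⟩ <;> cases b <;> simp [act]
  | cons i u ih => exact eA_good _ _ (by simp) _ ih

lemma pr_cons_pos {p : ℕ} {j : Fin (n + 1)} (v : List (Fin (n + 1))) (h : j.val + 1 = p ∨ j.val = p) :
    pr p (j :: v) = j :: pr p v := by simp [pr, h]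
lemma pr_cons_neg {p : ℕ} {j : Fin (n + 1)} (v : List (Fin (n + 1)))
    (h : ¬ (j.val + 1 = p ∨ j.val = p)) : pr p (j :: v) = pr p v := by
  unfold pr; rw [List.filter_cons_of_neg (by simpa using h)]
lemma pr_append {p : ℕ} (u v : List (Fin (n + 1))) : pr p (u ++ v) = pr p u ++ pr p v := by
  simp [pr]
lemma mem_pr {p : ℕ} {j : Fin (n + 1)} {v : List (Fin (n + 1))} :
    j ∈ pr p v ↔ j ∈ v ∧ (j.val + 1 = p ∨ j.val = p) := by simp [pr]

lemma Alt.tail {j : Fin (n + 1)} {v : List (Fin (n + 1))} (h : Alt (j :: v)) : Alt v := by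
  intro p
  have := h p
  by_cases hp : j.val + 1 = p ∨ j.val = p
  · rw [pr_cons_pos _ hp] at this; exact this.tail
  · rwa [pr_cons_neg _ hp] at this

lemma Alt.head {j : Fin (n + 1)} {v : List (Fin (n + 1))} (h : Alt (j :: v)) {p : ℕ}
    (hp : j.val + 1 = p ∨ j.val = p) {k : Fin (n + 1)} (hk : (pr p v).head? = some k) :
    k ≠ j ∧ (k.val + 1 = p ∨ k.val = p) := by
  have h1 := h p
  rw [pr_cons_pos _ hp] at h1
  have h2 := (mem_pr.1 (List.mem_of_head? hk)).2
  cases hv : pr p v with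
  | nil => simp [hv] at hk
  | cons a b =>
    rw [hv] at h1 hk
    simp at hk h1
    subst hk
    exact ⟨fun e => h1.1 e.symm, h2⟩

def TopOK (w : List (Fin (n + 1))) (p : ℕ) : Prop :=
  (pr p w = [] → act w (p, true) = (p, false)) ∧
  ∀ j, (pr p w).head? = some j →
    (j.val = p → p < (act w (p, true)).1) ∧ (j.val + 1 = p → (act w (p, true)).1 < p)

lemma side {j : Fin (n + 1)} {v : List (Fin (n + 1))} (h : Alt (j :: v)) (hv : ∀ p, TopOK v p) :
    (act v (j.val, true)).1 ≤ j.val ∧ j.val + 1 ≤ (act v (j.val + 1, true)).1 := by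
  constructor
  · obtain ⟨h1, h2⟩ := hv j.val
    cases hk : (pr j.val v).head? with
    | none => simp only [List.head?_eq_none_iff] at hk; rw [h1 hk]
    | some k =>
      obtain ⟨h3, h4⟩ := h.head (Or.inr rfl) hk
      have : k.val ≠ j.val := fun e => h3 (Fin.ext e)
      have := (h2 k hk).2 (by omega)
      omega
  · obtain ⟨h1, h2⟩ := hv (j.val + 1)
    cases hk : (pr (j.val + 1) v).head? with
    | none => simp only [List.head?_eq_none_iff] at hk; rw [h1 hk]
    | some k =>
      obtain ⟨h3, h4⟩ := h.head (Or.inl rfl) hk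
      have : k.val ≠ j.val := fun e => h3 (Fin.ext e)
      have := (h2 k hk).1 (by omega)
      omega

lemma eA_ne {j : ℕ} {s : ℕ × Bool → ℕ × Bool} {q : ℕ × Bool} (h1 : q ≠ (j, true)) (h2 : q ≠ (j + 1, true)) :
    (s q = (j, true) ∧ eA (j, true) (j + 1, true) s q = s (j + 1, true)) ∨
    (s q = (j + 1, true) ∧ eA (j, true) (j + 1, true) s q = s (j, true)) ∨
    (s q ≠ (j, true) ∧ s q ≠ (j + 1, true) ∧ eA (j, true) (j + 1, true) s q = s q) := by
  unfold eA
  rw [if_neg h1, if_neg h2]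
  by_cases h3 : s q = (j, true)
  · left; rw [if_pos h3]; exact ⟨h3, rfl⟩
  · by_cases h4 : s q = (j + 1, true)
    · right; left; rw [if_neg h3, if_pos h4]; exact ⟨h4, rfl⟩
    · right; right; rw [if_neg h3, if_neg h4]; exact ⟨h3, h4, rfl⟩

lemma eA_dir {j : ℕ} {s : ℕ × Bool → ℕ × Bool} (hs : Good s) {q : ℕ × Bool}
    (h1 : q ≠ (j, true)) (h2 : q ≠ (j + 1, true))
    (hl : (s (j, true)).1 ≤ j) (hr : j + 1 ≤ (s (j + 1, true)).1) :
    (q.1 < (s q).1 → q.1 < (eA (j, true) (j + 1, true) s q).1) ∧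
    ((s q).1 < q.1 → (eA (j, true) (j + 1, true) s q).1 < q.1) := by
  rcases eA_ne (s := s) h1 h2 with ⟨ha, hb⟩ | ⟨ha, hb⟩ | ⟨ha, ha', hb⟩
  · have : s (j, true) = q := by rw [← ha, hs.1]
    rw [this] at hl
    rw [hb, ha]
    simp only
    omega
  · have : s (j + 1, true) = q := by rw [← ha, hs.1]
    rw [this] at hr
    rw [hb, ha]
    simp only
    omega
  · rw [hb]; exact ⟨id, id⟩

lemma topOK (w : List (Fin (n + 1))) (h : Alt w) : ∀ p, TopOK w p := by
  induction w with
  | nil => intro p; refine ⟨fun _ => rfl, fun j hj => ?_⟩; simp [pr] at hj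
  | cons i u ih =>
    have hu := ih h.tail
    obtain ⟨hl, hr⟩ := side h hu
    intro p
    by_cases hp : i.val + 1 = p ∨ i.val = p
    · refine ⟨fun e => ?_, fun j hj => ?_⟩
      · rw [pr_cons_pos _ hp] at e; simp at e
      · rw [pr_cons_pos _ hp] at hj
        simp at hj
        subst hj
        constructor
        · rintro rfl; simp [act, eA]
        · rintro rfl; simp [act, eA]
    · have q1 : ((p, true) : ℕ × Bool) ≠ (i.val, true) := by
        intro e; simp at e; omega
      have q2 : ((p, true) : ℕ × Bool) ≠ (i.val + 1, true) := by
        intro e; simp at e; omega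
      have hd := eA_dir (act_good u) q1 q2 hl hr
      obtain ⟨h1, h2⟩ := hu p
      unfold TopOK
      rw [pr_cons_neg _ hp]
      refine ⟨fun e => ?_, fun j hj => ?_⟩
      · have := h1 e
        change eA _ _ _ _ = _
        rcases eA_ne (s := act u) q1 q2 with ⟨ha, hb⟩ | ⟨ha, hb⟩ | ⟨ha, ha', hb⟩
        · rw [this] at ha; simp at ha
        · rw [this] at ha; simp at ha
        · rw [hb, this]
      · exact ⟨fun e => hd.1 ((h2 j hj).1 e), fun e => hd.2 ((h2 j hj).2 e)⟩

def BotOK (w : List (Fin (n + 1))) (p : ℕ) : Prop :=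
  (pr p w = [] → act w (p, false) = (p, true)) ∧
  ∀ j, (pr p w).getLast? = some j →
    (j.val = p → p < (act w (p, false)).1) ∧ (j.val + 1 = p → (act w (p, false)).1 < p)

lemma botOK (w : List (Fin (n + 1))) (h : Alt w) : ∀ p, BotOK w p := by
  induction w with
  | nil => intro p; refine ⟨fun _ => rfl, fun j hj => ?_⟩; simp [pr] at hj
  | cons i u ih =>
    have hu := ih h.tail
    obtain ⟨hl, hr⟩ := side h (topOK u h.tail)
    intro p
    have q1 : ((p, false) : ℕ × Bool) ≠ (i.val, true) := by simp
    have q2 : ((p, false) : ℕ × Bool) ≠ (i.val + 1, true) := by simp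
    have hd := eA_dir (act_good u) q1 q2 hl hr
    obtain ⟨h1, h2⟩ := hu p
    by_cases hp : i.val + 1 = p ∨ i.val = p
    · refine ⟨fun e => ?_, fun j hj => ?_⟩
      · rw [pr_cons_pos _ hp] at e; simp at e
      · rw [pr_cons_pos _ hp] at hj
        by_cases he : pr p u = []
        · rw [he] at hj
          simp at hj
          subst hj
          have hz := h1 he
          have hact : act (i :: u) = eA (i.val, true) (i.val + 1, true) (act u) := rfl
          constructor
          · rintro rfl
            rw [hact]
            simp [eA, hz]; omega
          · rintro rfl
            rw [hact]
            simp [eA, hz]; omega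
        · have hj' : (pr p u).getLast? = some j := by
            rw [List.getLast?_cons] at hj
            rw [List.getLast?_eq_some_getLast he] at hj ⊢
            simpa using hj
          exact ⟨fun e => hd.1 ((h2 j hj').1 e), fun e => hd.2 ((h2 j hj').2 e)⟩
    · unfold BotOK
      rw [pr_cons_neg _ hp]
      refine ⟨fun e => ?_, fun j hj => ?_⟩
      · have := h1 e
        change eA _ _ _ _ = _
        rcases eA_ne (s := act u) q1 q2 with ⟨ha, hb⟩ | ⟨ha, hb⟩ | ⟨ha, ha', hb⟩
        · rw [this] at ha; simp at ha; omega
        · rw [this] at ha; simp at ha; omega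
        · rw [hb, this]
      · exact ⟨fun e => hd.1 ((h2 j hj).1 e), fun e => hd.2 ((h2 j hj).2 e)⟩

/-- head of projection is determined by the diagram -/
lemma head_eq {w w' : List (Fin (n + 1))} (h : Alt w) (h' : Alt w') (e : act w = act w') (p : ℕ) :
    (pr p w).head? = (pr p w').head? := by
  obtain ⟨a1, a2⟩ := topOK w h p
  obtain ⟨b1, b2⟩ := topOK w' h' p
  rw [← e] at b1 b2
  cases hk : (pr p w).head? with
  | none =>
    cases hk' : (pr p w').head? with
    | none => rfl
    | some k' =>
      simp only [List.head?_eq_none_iff] at hk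
      have := a1 hk
      have := (mem_pr.1 (List.mem_of_head? hk')).2
      have := b2 k' hk'
      grind
  | some k =>
    have hk2 := (mem_pr.1 (List.mem_of_head? hk)).2
    have := a2 k hk
    cases hk' : (pr p w').head? with
    | none =>
      simp only [List.head?_eq_none_iff] at hk'
      have := b1 hk'
      grind
    | some k' =>
      have := (mem_pr.1 (List.mem_of_head? hk')).2
      have := b2 k' hk'
      congr 1
      apply Fin.ext
      omega

lemma last_eq {w w' : List (Fin (n + 1))} (h : Alt w) (h' : Alt w') (e : act w = act w') (p : ℕ) :
    (pr p w).getLast? = (pr p w').getLast? := by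
  obtain ⟨a1, a2⟩ := botOK w h p
  obtain ⟨b1, b2⟩ := botOK w' h' p
  rw [← e] at b1 b2
  cases hk : (pr p w).getLast? with
  | none =>
    cases hk' : (pr p w').getLast? with
    | none => rfl
    | some k' =>
      simp only [List.getLast?_eq_none_iff] at hk
      have := a1 hk
      have := (mem_pr.1 (List.mem_of_getLast? hk')).2
      have := b2 k' hk'
      grind
  | some k =>
    have hk2 := (mem_pr.1 (List.mem_of_getLast? hk)).2
    have := a2 k hk
    cases hk' : (pr p w').getLast? with
    | none =>
      simp only [List.getLast?_eq_none_iff] at hk'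
      have := b1 hk'
      grind
    | some k' =>
      have := (mem_pr.1 (List.mem_of_getLast? hk')).2
      have := b2 k' hk'
      congr 1
      apply Fin.ext
      omega

/-- alternating lists with same head, last and number of letters `p-1` agree -/
lemma alt_list (p : ℕ) : ∀ (r r' : List (Fin (n + 1))), r.IsChain (· ≠ ·) → r'.IsChain (· ≠ ·) →
    (∀ x ∈ r, x.val + 1 = p ∨ x.val = p) → (∀ x ∈ r', x.val + 1 = p ∨ x.val = p) →
    r.head? = r'.head? → r.getLast? = r'.getLast? →
    r.countP (fun x => decide (x.val + 1 = p)) = r'.countP (fun x => decide (x.val + 1 = p)) → r = r' := by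
  intro r
  induction r with
  | nil => intro r' _ _ _ _ h _ _; simpa [eq_comm] using h
  | cons x r ih =>
    intro r' hc hc' hm hm' hh hl hcount
    cases r' with
    | nil => simp at hh
    | cons x' r' =>
      simp at hh
      subst hh
      cases r with
      | nil =>
        cases r' with
        | nil => rfl
        | cons y r' =>
          exfalso
          have hy := hm' y (by simp)
          have hx := hm x (by simp)
          have hxy : x ≠ y := by simp at hc'; exact hc'.1
          have hxy' : x.val ≠ y.val := fun e => hxy (Fin.ext e)
          have hlast : x ∈ y :: r' := by
            apply List.mem_of_getLast? (a := x)
            simp at hl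
            exact hl.symm
          simp only [List.countP_cons, List.countP_nil] at hcount
          have : x ∈ r' := by simpa [hxy] using hlast
          rcases hx with hx | hx
          · have : 0 < r'.countP (fun x => decide (x.val + 1 = p)) :=
              List.countP_pos_iff.2 ⟨x, this, by simpa using hx⟩
            simp [hx] at hcount
            grind
          · have h1 : y.val + 1 = p := by omega
            have h2 : ¬ x.val + 1 = p := by omega
            simp [h1, h2] at hcount
      | cons y r =>
        cases r' with
        | nil =>
          exfalso
          have hy := hm y (by simp)
          have hx := hm x (by simp)
          have hxy : x ≠ y := by simp at hc; exact hc.1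
          have hxy' : x.val ≠ y.val := fun e => hxy (Fin.ext e)
          have hlast : x ∈ y :: r := by
            apply List.mem_of_getLast? (a := x)
            simp at hl
            exact hl
          simp only [List.countP_cons, List.countP_nil] at hcount
          have : x ∈ r := by simpa [hxy] using hlast
          rcases hx with hx | hx
          · have : 0 < r.countP (fun x => decide (x.val + 1 = p)) :=
              List.countP_pos_iff.2 ⟨x, this, by simpa using hx⟩
            simp [hx] at hcount
            grind
          · have h1 : y.val + 1 = p := by omega
            have h2 : ¬ x.val + 1 = p := by omega
            simp [h1, h2] at hcount
        | cons y' r' =>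
          have hy := hm y (by simp)
          have hy' := hm' y' (by simp)
          have hx := hm x (by simp)
          have e1 : x ≠ y := by simp at hc; exact hc.1
          have e2 : x ≠ y' := by simp at hc'; exact hc'.1
          have e3 : x.val ≠ y.val := fun e => e1 (Fin.ext e)
          have e4 : x.val ≠ y'.val := fun e => e2 (Fin.ext e)
          congr 1
          apply ih _ hc.tail hc'.tail
          · intro z hz; exact hm z (List.mem_cons_of_mem _ hz)
          · intro z hz; exact hm' z (List.mem_cons_of_mem _ hz)
          · simp; apply Fin.ext; omega
          · simpa [List.getLast?_cons] using hl
          · rw [List.countP_cons, List.countP_cons (a := x)] at hcount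
            simp only [List.tail_cons]
            omega

lemma pr_count (p : ℕ) (w : List (Fin (n + 1))) :
    (pr (p + 1) w).countP (fun x => decide (x.val + 1 = p + 1)) =
    (pr p w).countP (fun x => decide (x.val = p)) := by
  unfold pr
  rw [List.countP_filter, List.countP_filter]
  congr 1
  funext x
  by_cases h : x.val = p <;> simp [h]

lemma pr_eq {w w' : List (Fin (n + 1))} (h : Alt w) (h' : Alt w') (e : act w = act w') (p : ℕ) :
    pr p w = pr p w' := by
  induction p with
  | zero =>
    apply alt_list 0 _ _ (h _) (h' _) (fun x hx => (mem_pr.1 hx).2) (fun x hx => (mem_pr.1 hx).2)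
      (head_eq h h' e _) (last_eq h h' e _)
    simp
  | succ p ih =>
    apply alt_list (p + 1) _ _ (h _) (h' _) (fun x hx => (mem_pr.1 hx).2) (fun x hx => (mem_pr.1 hx).2)
      (head_eq h h' e _) (last_eq h h' e _)
    rw [pr_count, pr_count, ih]
end
section
variable {n : ℕ}

lemma cval_two {a b : ℕ} : cval n a b = 2 ↔ a ≠ b ∧ a + 1 ≠ b ∧ b + 1 ≠ a := by
  unfold cval; grind
lemma aval_two {a b : ℕ} : aval a b = 2 ↔ a ≠ b ∧ a + 1 ≠ b ∧ b + 1 ≠ a := by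
  unfold aval; grind
lemma aval_three {a b : ℕ} : aval a b = 3 ↔ a + 1 = b ∨ b + 1 = a := by
  unfold aval; grind

lemma CM_two {i j : Fin (n + 1)} :
    (CMat n).M i j = 2 ↔ i.val ≠ j.val ∧ i.val + 1 ≠ j.val ∧ j.val + 1 ≠ i.val := cval_two
lemma AM_two {i j : Fin (n + 1)} :
    (AMat n).M i j = 2 ↔ i.val ≠ j.val ∧ i.val + 1 ≠ j.val ∧ j.val + 1 ≠ i.val := aval_two
lemma AM_three {i j : Fin (n + 1)} :
    (AMat n).M i j = 3 ↔ i.val + 1 = j.val ∨ j.val + 1 = i.val := aval_three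

lemma ce_A_C (l l' : List (Fin (n + 1))) : CommEquiv (AMat n) l l' ↔ CommEquiv (CMat n) l l' := by
  have : CommMove (AMat n) = CommMove (CMat n) := by
    funext l l'
    unfold CommMove
    simp only [CM_two, AM_two]
  unfold CommEquiv
  rw [this]

lemma ce_symm {l l' : List (Fin (n + 1))} (h : CommEquiv (CMat n) l l') : CommEquiv (CMat n) l' l := by
  induction h with
  | refl => exact Relation.ReflTransGen.refl
  | tail _ h ih =>
    refine Relation.ReflTransGen.head ?_ ih
    obtain ⟨u, v, i, j, h1, h2, h3⟩ := h
    exact ⟨u, v, j, i, CM_two.2 (by have := CM_two.1 h1; omega), h3, h2⟩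

lemma ce_append {l l' : List (Fin (n + 1))} (h : CommEquiv (CMat n) l l') (a b : List (Fin (n + 1))) :
    CommEquiv (CMat n) (a ++ l ++ b) (a ++ l' ++ b) := by
  induction h with
  | refl => exact Relation.ReflTransGen.refl
  | tail _ h ih =>
    refine Relation.ReflTransGen.tail ih ?_
    obtain ⟨u, v, i, j, h1, h2, h3⟩ := h
    exact ⟨a ++ u, v ++ b, i, j, h1, by simp [h2], by simp [h3]⟩

/-- move a letter through a commuting block -/
lemma ce_move (j : Fin (n + 1)) (B : List (Fin (n + 1))) (h : ∀ x ∈ B, (CMat n).M j x = 2) :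
    CommEquiv (CMat n) (j :: B) (B ++ [j]) := by
  induction B with
  | nil => exact Relation.ReflTransGen.refl
  | cons b B ih =>
    have h1 : CommMove (CMat n) (j :: b :: B) (b :: j :: B) :=
      ⟨[], B, j, b, h b (by simp), rfl, rfl⟩
    refine Relation.ReflTransGen.head h1 ?_
    have := ce_append (ih fun x hx => h x (by simp [hx])) [b] []
    simp only [List.append_nil] at this
    exact this

lemma nf_core (w : List (Fin (n + 1))) (hw : NoForkWord n w) : ∀ (N : ℕ) (A B D : List (Fin (n + 1)))
    (j : Fin (n + 1)), B.length ≤ N → w = A ++ j :: B ++ j :: D → j ∉ B →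
    ((∀ x ∈ B, x.val + 1 ≠ j.val) ∨ (∀ x ∈ B, j.val + 1 ≠ x.val)) → False := by
  intro N
  induction N with
  | zero =>
    intro A B D j hB e _ _
    have : B = [] := by simpa using hB
    subst this
    exact (hw w Relation.ReflTransGen.refl).2 ⟨A, D, j, by simpa using e⟩
  | succ N ih =>
    intro A B D j hB e hj hside
    by_cases hk : ∃ k ∈ B, adjIdx j k
    · obtain ⟨k, hkB, hadj⟩ := hk
      have huniq : ∀ x ∈ B, adjIdx j x → x = k := by
        intro x hx hxa
        apply Fin.ext
        unfold adjIdx at *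
        rcases hside with h | h
        · have := h x hx; have := h k hkB; omega
        · have := h x hx; have := h k hkB; omega
      obtain ⟨B1, B2, hB12, hk1⟩ : ∃ s t, B = s ++ k :: t ∧ k ∉ s := by
        have := List.eq_append_cons_of_mem hkB
        simpa using this
      have hcomm : ∀ x ∈ B, x ≠ k → (CMat n).M j x = 2 := by
        intro x hx hxk
        apply CM_two.2
        have h1 : ¬ adjIdx j x := fun h => hxk (huniq x hx h)
        have h2 : x.val ≠ j.val := fun h => hj (by rwa [← Fin.ext h])
        unfold adjIdx at h1
        omega
      by_cases hk2 : k ∈ B2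
      · obtain ⟨B3, B4, hB34, hk3⟩ : ∃ s t, B2 = s ++ k :: t ∧ k ∉ s := by
          have := List.eq_append_cons_of_mem hk2
          simpa using this
        subst hB34
        subst hB12
        refine ih (A ++ j :: B1) B3 (B4 ++ j :: D) k ?_ ?_ hk3 ?_
        · simp at hB; omega
        · rw [e]; simp
        · have hj3 : ∀ x ∈ B3, x.val ≠ j.val := by
            intro x hx h
            apply hj
            rw [← Fin.ext h]
            simp [hx]
          rcases hadj with h | h
          · left; intro x hx; have := hj3 x hx; omega
          · right; intro x hx; have := hj3 x hx; omega
      · have m1 := ce_move j B1 (fun x hx => hcomm x (by simp [hB12, hx]) (by rintro rfl; exact hk1 hx))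
        have m2 := ce_symm (ce_move j B2 (fun x hx => hcomm x (by simp [hB12, hx]) (by rintro rfl; exact hk2 hx)))
        have g1 := ce_append m1 A (k :: B2 ++ j :: D)
        have g2 := ce_append m2 (A ++ (B1 ++ [j]) ++ [k]) D
        have g3 : CommEquiv (CMat n) w (A ++ (B1 ++ [j]) ++ (k :: B2 ++ j :: D)) := by
          have : w = A ++ j :: B1 ++ (k :: B2 ++ j :: D) := by rw [e, hB12]; simp
          rw [this]; exact g1
        have g4 : CommEquiv (CMat n) (A ++ (B1 ++ [j]) ++ (k :: B2 ++ j :: D))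
            (A ++ (B1 ++ [j]) ++ [k] ++ j :: B2 ++ D) := by
          have : A ++ (B1 ++ [j]) ++ (k :: B2 ++ j :: D)
            = A ++ (B1 ++ [j]) ++ [k] ++ (B2 ++ [j]) ++ D := by simp
          rw [this]; exact g2
        exact (hw _ (Relation.ReflTransGen.trans g3 g4)).1 ⟨A ++ B1, B2 ++ D, j, k, hadj, by simp⟩
    · have hcomm : ∀ x ∈ B, (CMat n).M j x = 2 := by
        intro x hx
        apply CM_two.2
        have h1 : ¬ adjIdx j x := fun h => hk ⟨x, hx, h⟩
        have h2 : x.val ≠ j.val := fun h => hj (by rwa [← Fin.ext h])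
        unfold adjIdx at h1
        omega
      have h1 := ce_append (ce_move j B hcomm) A (j :: D)
      have h2 : CommEquiv (CMat n) w (A ++ (B ++ [j]) ++ j :: D) := by rw [e]; simpa using h1
      exact (hw _ h2).2 ⟨A ++ B, D, j, by simp⟩

lemma not_chain {l : List (Fin (n + 1))} (h : ¬ l.IsChain (· ≠ ·)) : ∃ a b j, l = a ++ j :: j :: b := by
  induction l with
  | nil => simp at h
  | cons x r ih =>
    by_cases hr : r.IsChain (· ≠ ·)
    · cases r with
      | nil => simp at h
      | cons y r =>
        simp only [List.isChain_cons_cons, not_and] at h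
        by_cases hxy : x = y
        · subst hxy; exact ⟨[], r, x, rfl⟩
        · exact absurd hr (h hxy)
    · obtain ⟨a, b, j, e⟩ := ih hr
      exact ⟨x :: a, b, j, by simp [e]⟩

lemma nf_alt (w : List (Fin (n + 1))) (hw : NoForkWord n w) : Alt w := by
  intro p
  by_contra hc
  obtain ⟨a, b, j, e⟩ := not_chain hc
  have hjp : j.val + 1 = p ∨ j.val = p := (mem_pr.1 (by rw [e]; simp : j ∈ pr p w)).2
  unfold pr at e
  rw [List.filter_eq_append_iff] at e
  obtain ⟨l1, l2, hw12, _, h2⟩ := e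
  rw [List.filter_eq_cons_iff] at h2
  obtain ⟨A', l3, hl2, _, _, h3⟩ := h2
  rw [List.filter_eq_cons_iff] at h3
  obtain ⟨B, D, hl3, hB, _, _⟩ := h3
  have hB' : ∀ x ∈ B, ¬ (x.val + 1 = p ∨ x.val = p) := by
    intro x hx; simpa using hB x hx
  refine nf_core w hw B.length (l1 ++ A') B D j le_rfl ?_ ?_ ?_
  · rw [hw12, hl2, hl3]; simp
  · intro h; exact hB' j h hjp
  · rcases hjp with h | h
    · right; intro x hx; have := hB' x hx; omega
    · left; intro x hx; have := hB' x hx; omega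

lemma pr_ce : ∀ (w w' : List (Fin (n + 1))), (∀ p, pr p w = pr p w') → CommEquiv (CMat n) w w' := by
  intro w
  induction w with
  | nil =>
    intro w' h
    cases w' with
    | nil => exact Relation.ReflTransGen.refl
    | cons x r =>
      have := h x.val
      rw [pr_cons_pos _ (Or.inr rfl)] at this
      simp [pr] at this
  | cons a u ih =>
    intro w' h
    have ha : a ∈ w' := by
      have h1 : a ∈ pr a.val (a :: u) := by rw [pr_cons_pos _ (Or.inr rfl)]; simp
      rw [h] at h1
      exact (mem_pr.1 h1).1
    obtain ⟨B, D, e, haB⟩ : ∃ s t, w' = s ++ a :: t ∧ a ∉ s := by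
      have := List.eq_append_cons_of_mem ha
      simpa using this
    subst e
    have key : ∀ p, (a.val + 1 = p ∨ a.val = p) → pr p B = [] ∧ pr p u = pr p D := by
      intro p hp
      have h1 := h p
      rw [pr_append, pr_cons_pos _ hp, pr_cons_pos _ hp] at h1
      cases hB : pr p B with
      | nil => rw [hB] at h1; simp at h1; exact ⟨rfl, h1⟩
      | cons b r =>
        rw [hB] at h1
        simp at h1
        exfalso
        apply haB
        have : b ∈ pr p B := by rw [hB]; simp
        rw [h1.1]
        exact (mem_pr.1 this).1
    have hcomm : ∀ x ∈ B, (CMat n).M a x = 2 := by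
      intro x hx
      have k1 := (key a.val (Or.inr rfl)).1
      have k2 := (key (a.val + 1) (Or.inl rfl)).1
      have g1 : x ∉ pr a.val B := by rw [k1]; simp
      have g2 : x ∉ pr (a.val + 1) B := by rw [k2]; simp
      rw [mem_pr] at g1 g2
      apply CM_two.2
      simp only [hx, true_and] at g1 g2
      omega
    have h1 := ce_append (ce_move a B hcomm) [] D
    have h2 : CommEquiv (CMat n) u (B ++ D) := by
      apply ih
      intro p
      by_cases hp : a.val + 1 = p ∨ a.val = p
      · obtain ⟨k1, k2⟩ := key p hp
        rw [pr_append, k1, k2]; simp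
      · have := h p
        rw [pr_append, pr_cons_neg _ hp, pr_cons_neg _ hp] at this
        rw [pr_append, this]
    have h3 := ce_append h2 [a] []
    have h4 : CommEquiv (CMat n) (a :: u) (a :: (B ++ D)) := by simpa using h3
    have h5 : CommEquiv (CMat n) (a :: (B ++ D)) (B ++ a :: D) := by simpa using h1
    exact Relation.ReflTransGen.trans h4 h5

/-! representation -/
noncomputable section

abbrev St : Type := {s : ℕ × Bool → ℕ × Bool // Good s}

def eS (i : ℕ) (s : St) : St := ⟨eA (i, true) (i + 1, true) s.1, eA_good _ _ (by simp) _ s.2⟩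
def epS (i : ℕ) (s : St) : ℕ := ep (i, true) (i + 1, true) s.1

open Polynomial in
def G (i : ℕ) : Module.End (Polynomial ℤ) (St →₀ Polynomial ℤ) :=
  Finsupp.linearCombination (Polynomial ℤ) (fun s => Finsupp.single (eS i s) ((X : Polynomial ℤ) ^ epS i s))

open Polynomial in
lemma G_single (i : ℕ) (s : St) (c : ℤ[X]) :
    G i (Finsupp.single s c) = Finsupp.single (eS i s) (c * X ^ epS i s) := by
  simp [G]

lemma G_sq (i : ℕ) : G i * G i = (Polynomial.X : Polynomial ℤ) • G i := by
  ext s : 2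
  have h1 : eS i (eS i s) = eS i s := Subtype.ext (eA_idem _ _ _)
  have h2 : epS i (eS i s) = 1 := ep_idem _ _ _
  simp [G_single, h1, h2, mul_comm]

lemma G_comm (i j : ℕ) (h : i ≠ j ∧ i + 1 ≠ j ∧ j + 1 ≠ i) : G i * G j = G j * G i := by
  ext s : 2
  have h1 : eS i (eS j s) = eS j (eS i s) :=
    Subtype.ext (eA_comm _ _ _ _ _ s.2 (by simp) (by simp) (by simp; omega) (by simp; omega)
      (by simp; omega) (by simp; omega))
  have h2 : epS j s + epS i (eS j s) = epS i s + epS j (eS i s) :=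
    ep_comm _ _ _ _ _ s.2 (by simp) (by simp) (by simp; omega) (by simp; omega)
      (by simp; omega) (by simp; omega)
  simp [G_single, h1, ← pow_add, h2]

lemma G_braid (i j : ℕ) (h : i + 1 = j ∨ j + 1 = i) : G i * G j * G i = G i := by
  ext s : 2
  rcases h with rfl | rfl
  · have h1 : eS i (eS (i + 1) (eS i s)) = eS i s :=
      Subtype.ext (eA_braid _ _ _ _ s.2 (by simp) (by simp; omega) (by simp))
    obtain ⟨h2, h3⟩ := ep_braid (i, true) (i + 1, true) (i + 1 + 1, true) _ s.2 (by simp) (by simp; omega) (by simp)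
    have h2' : epS (i + 1) (eS i s) = 0 := h2
    have h3' : epS i (eS (i + 1) (eS i s)) = 0 := h3
    simp [G_single, h1, h2', h3']
  · have h1 : eS (j + 1) (eS j (eS (j + 1) s)) = eS (j + 1) s := by
      apply Subtype.ext
      have := eA_braid (j + 1 + 1, true) (j + 1, true) (j, true) _ s.2 (by simp) (by simp; omega) (by simp)
      rw [eA_symm (j + 1 + 1, true), eA_symm _ (j, true), eA_symm (j + 1 + 1, true)] at this
      exact this
    have hep : ∀ (a b : ℕ × Bool) (s : ℕ × Bool → ℕ × Bool), Good s → ep a b s = ep b a s := by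
      intro a b s hs
      have e1 := hs.1 a
      have e2 := hs.1 b
      unfold ep
      grind
    obtain ⟨h2, h3⟩ := ep_braid (j + 1 + 1, true) (j + 1, true) (j, true) _ s.2 (by simp) (by simp; omega) (by simp)
    rw [eA_symm (j + 1 + 1, true)] at h2 h3
    rw [eA_symm _ (j, true)] at h3
    rw [hep _ _ _ (eA_good _ _ (by simp) _ s.2)] at h2
    rw [hep _ _ _ (eA_good _ _ (by simp) _ (eA_good _ _ (by simp) _ s.2))] at h3
    have h2' : epS j (eS (j + 1) s) = 0 := h2
    have h3' : epS (j + 1) (eS j (eS (j + 1) s)) = 0 := h3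
    simp [G_single, h1, h2', h3']

def rep (n : ℕ) : TLA n →ₐ[Polynomial ℤ] Module.End (Polynomial ℤ) (St →₀ Polynomial ℤ) :=
  RingQuot.liftAlgHom (Polynomial ℤ) ⟨FreeAlgebra.lift (Polynomial ℤ) (fun i : Fin (n + 1) => G i.val), by
    intro x y h
    cases h with
    | sq i => simp [G_sq]
    | comm i j h => simp [G_comm _ _ (aval_two.1 h)]
    | braid i j h => simp [G_braid _ _ (aval_three.1 h)]⟩

lemma rep_gen (i : Fin (n + 1)) : rep n (tlGen n i) = G i.val := by
  simp [rep, tlGen]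

lemma rep_bProd (w : List (Fin (n + 1))) (h : Alt w) :
    rep n (bProd n w) (Finsupp.single ⟨act [] , act_good (n := n) []⟩ 1) =
      Finsupp.single ⟨act w, act_good w⟩ 1 := by
  induction w with
  | nil => simp [bProd]
  | cons i u ih =>
    have e : bProd n (i :: u) = tlGen n i * bProd n u := by simp [bProd]
    rw [e, map_mul, Module.End.mul_apply, ih h.tail, rep_gen, G_single]
    have h1 : epS i.val ⟨act u, act_good u⟩ = 0 := by
      obtain ⟨hl, hr⟩ := side h (topOK u h.tail)
      unfold epS ep
      rw [if_neg]
      intro e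
      simp only at e
      rw [e] at hl
      simp at hl
    rw [h1]
    simp
    rfl

lemma inj {w w' : List (Fin (n + 1))} (h : NoForkWord n w) (h' : NoForkWord n w') {a b : ℕ}
    (e : tlδ n ^ a * bProd n w = tlδ n ^ b * bProd n w') : CommEquiv (CMat n) w w' ∧ a = b := by
  have hA := nf_alt w h
  have hA' := nf_alt w' h'
  have e2 := congrArg (fun x => rep n x (Finsupp.single ⟨act [] , act_good (n := n) []⟩ 1)) e
  simp only [map_mul, map_pow, tlδ, AlgHom.commutes, Module.End.mul_apply, rep_bProd _ hA,
    rep_bProd _ hA'] at e2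
  rw [← map_pow, ← map_pow] at e2
  simp only [Module.algebraMap_end_apply, Finsupp.smul_single, smul_eq_mul, mul_one] at e2
  rw [Finsupp.single_eq_single_iff] at e2
  have hX : (Polynomial.X : Polynomial ℤ) ^ a ≠ 0 := pow_ne_zero _ Polynomial.X_ne_zero
  rcases e2 with ⟨e3, e4⟩ | ⟨e3, _⟩
  · refine ⟨pr_ce _ _ (pr_eq hA hA' (congrArg Subtype.val e3)), ?_⟩
    have := congrArg Polynomial.natDegree e4
    simpa using this
  · exact absurd e3 hX

lemma gen_rel {i j : Fin (n + 1)} : (aval i.val j.val = 2 → tlGen n i * tlGen n j = tlGen n j * tlGen n i)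
    ∧ (aval i.val j.val = 3 → tlGen n i * tlGen n j * tlGen n i = tlGen n i)
    ∧ tlGen n i * tlGen n i = tlδ n * tlGen n i := by
  refine ⟨fun h => ?_, fun h => ?_, ?_⟩
  · have := RingQuot.mkAlgHom_rel (Polynomial ℤ) (TLRel.comm i j h)
    simpa [tlGen] using this
  · have := RingQuot.mkAlgHom_rel (Polynomial ℤ) (TLRel.braid i j h)
    simpa [tlGen] using this
  · have := RingQuot.mkAlgHom_rel (Polynomial ℤ) (TLRel.sq i)
    rw [map_mul, map_smul, Algebra.smul_def] at this
    exact this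

lemma bProd_append (u v : List (Fin (n + 1))) : bProd n (u ++ v) = bProd n u * bProd n v := by
  simp [bProd]
lemma bProd_cons (i : Fin (n + 1)) (v : List (Fin (n + 1))) : bProd n (i :: v) = tlGen n i * bProd n v := by
  simp [bProd]

lemma rstep_inv {x y : List (Fin (n + 1)) × ℕ} (h : RStep n x y) :
    tlδ n ^ x.2 * bProd n x.1 = tlδ n ^ y.2 * bProd n y.1 := by
  cases h with
  | comm h =>
    obtain ⟨u, v, i, j, h1, rfl, rfl⟩ := h
    have := (gen_rel (i := i) (j := j)).1 (aval_two.2 (CM_two.1 h1))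
    simp only [bProd_append, bProd_cons]
    rw [← mul_assoc (tlGen n i), this, mul_assoc (tlGen n j)]
  | fork u v i j c h =>
    have := (gen_rel (i := i) (j := j)).2.1 (aval_three.2 h)
    simp only [bProd_append, bProd_cons]
    rw [← mul_assoc (tlGen n j), ← mul_assoc (tlGen n i), ← mul_assoc (tlGen n i), this]
  | merge u v i c =>
    have := (gen_rel (i := i) (j := i)).2.2
    have hc : tlδ n * bProd n u = bProd n u * tlδ n := Algebra.commutes _ _
    simp only [bProd_append, bProd_cons]
    rw [← mul_assoc (tlGen n i), this, pow_succ]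
    simp only [mul_assoc]
    rw [← mul_assoc (tlδ n) (bProd n u), hc, mul_assoc]

lemma run_inv {x y : List (Fin (n + 1)) × ℕ} (h : Relation.ReflTransGen (RStep n) x y) :
    tlδ n ^ x.2 * bProd n x.1 = tlδ n ^ y.2 * bProd n y.1 := by
  induction h with
  | refl => rfl
  | tail _ h ih => rw [ih, rstep_inv h]

/-! reduced words of FC elements have no forks -/
lemma ce_perm {B : Type*} {Mx : CoxeterMatrix B} {l l' : List B} (h : CommEquiv Mx l l') : l.Perm l' := by
  induction h with
  | refl => exact List.Perm.refl _
  | tail _ h ih =>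
    obtain ⟨u, v, i, j, _, rfl, rfl⟩ := h
    exact ih.trans ((List.Perm.swap _ _ _).append_left u)

lemma ce_prod {l l' : List (Fin (n + 1))} (h : CommEquiv (CMat n) l l') :
    (csA n).wordProd l = (csA n).wordProd l' := by
  induction h with
  | refl => rfl
  | tail _ h ih =>
    obtain ⟨u, v, i, j, h1, rfl, rfl⟩ := h
    rw [ih]
    have h2 := (csA n).simple_mul_simple_pow i j
    have h3 : (AMat n).M i j = 2 := AM_two.2 (CM_two.1 h1)
    rw [h3] at h2
    have h4 : (csA n).simple i * (csA n).simple j = (csA n).simple j * (csA n).simple i := by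
      rw [pow_two] at h2
      have := eq_inv_of_mul_eq_one_left h2
      simpa using this
    simp only [CoxeterSystem.wordProd_append, CoxeterSystem.wordProd_cons]
    rw [← mul_assoc ((csA n).simple i), h4, mul_assoc]

lemma ce_red {l l' : List (Fin (n + 1))} (h : CommEquiv (CMat n) l l') (hl : (csA n).IsReduced l) :
    (csA n).IsReduced l' := by
  unfold CoxeterSystem.IsReduced at *
  rw [← ce_prod h, hl, (ce_perm h).length_eq]

lemma fc_nofork {t : WA n} (ht : IsFC (csA n) t) {m : List (Fin (n + 1))} (hm : (csA n).IsReduced m)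
    (hmt : (csA n).wordProd m = t) : NoForkWord n m := by
  intro l' hl'
  have hr := ce_red hl' hm
  have hp : (csA n).wordProd l' = t := by rw [← ce_prod hl', hmt]
  constructor
  · rintro ⟨u, v, i, j, hadj, rfl⟩
    have h3 : (AMat n).M i j = 3 := AM_three.2 hadj
    have h2 := (csA n).simple_mul_simple_pow i j
    rw [h3] at h2
    have hb : (csA n).simple i * (csA n).simple j * (csA n).simple i
        = (csA n).simple j * (csA n).simple i * (csA n).simple j := by
      have h4 : ((csA n).simple i * (csA n).simple j * (csA n).simple i) *
        ((csA n).simple j * (csA n).simple i * (csA n).simple j) = 1 := by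
        rw [← h2]; simp only [pow_succ, pow_zero, one_mul, mul_assoc]
      have := eq_inv_of_mul_eq_one_left h4
      simpa [mul_assoc] using this
    have hprod : (csA n).wordProd (u ++ j :: i :: j :: v) = (csA n).wordProd (u ++ i :: j :: i :: v) := by
      simp only [CoxeterSystem.wordProd_append, CoxeterSystem.wordProd_cons]
      simp only [← mul_assoc] at hb ⊢
      simp only [mul_assoc] at hb ⊢
      have := congrArg (· * (csA n).wordProd v) hb
      simp only [mul_assoc] at this
      rw [this]
    have hr' : (csA n).IsReduced (u ++ j :: i :: j :: v) := by
      unfold CoxeterSystem.IsReduced at *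
      rw [hprod, hr]; simp
    have hce := ht _ _ hr hp hr' (by rw [hprod, hp])
    have hcount := (ce_perm hce).count_eq i
    have hij : j ≠ i := by
      rintro rfl
      unfold adjIdx at hadj; omega
    simp [List.count_cons, hij, hij.symm] at hcount
  · rintro ⟨u, v, i, rfl⟩
    have hprod : (csA n).wordProd (u ++ i :: i :: v) = (csA n).wordProd (u ++ v) := by
      simp [CoxeterSystem.wordProd_append, CoxeterSystem.wordProd_cons]
    unfold CoxeterSystem.IsReduced at hr
    rw [hprod] at hr
    have := (csA n).length_wordProd_le (u ++ v)
    rw [hr] at this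
    simp at this
end
end

/-- Let `w̃ ∈ FC(C̃ₙ)` and let `H := H(w̃)` be its heap, given by the
commutation class of any reduced word of `w̃`.  The heap `𝔑(H)` produced by the reduction
algorithm and the integer `del(H)` do not depend on the order in which the forks are
eliminated; moreover `𝔑(H) = H(τ(w̃))` and `del(H) = α(w̃)`, where `α(w̃) ∈ ℕ` and
`τ(w̃) ∈ FC(A_{n+1})` are determined by `b_{i₁} ⋯ b_{i_k} = δ^{α(w̃)} b_{τ(w̃)}`. -/
theorem statement1 (n : ℕ) (hn : 2 ≤ n) (w : WC n) (hw : IsFC (csC n) w)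
    -- `α` and `τ(w̃)`, characterized by the Temperley–Lieb identity
    -- `b_{i₁} ⋯ b_{i_k} = δ^α b_τ`:
    (α : ℕ) (t : WA n) (ht : IsFC (csA n) t)
    (hchar : ∀ l : List (Fin (n + 1)), (csC n).IsReduced l → (csC n).wordProd l = w →
      ∀ m : List (Fin (n + 1)), (csA n).IsReduced m → (csA n).wordProd m = t →
        bProd n l = tlδ n ^ α * bProd n m)
    -- two runs of the reduction algorithm, started from (possibly different)
    -- reduced words of `w̃` and both run until no fork remains:
    (l₁ l₂ : List (Fin (n + 1)))
    (hl₁ : (csC n).IsReduced l₁) (hw₁ : (csC n).wordProd l₁ = w)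
    (hl₂ : (csC n).IsReduced l₂) (hw₂ : (csC n).wordProd l₂ = w)
    (m₁ m₂ : List (Fin (n + 1))) (c₁ c₂ : ℕ)
    (hr₁ : Relation.ReflTransGen (RStep n) (l₁, 0) (m₁, c₁))
    (hr₂ : Relation.ReflTransGen (RStep n) (l₂, 0) (m₂, c₂))
    (hm₁ : NoForkWord n m₁) (hm₂ : NoForkWord n m₂) :
    -- the outcome does not depend on the order of elimination of the forks:
    CommEquiv (CMat n) m₁ m₂ ∧ c₁ = c₂ ∧
    -- `𝔑(H) = H(τ(w̃))`:
    (csA n).IsReduced m₁ ∧ (csA n).wordProd m₁ = t ∧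
    -- `del(H) = α(w̃)`:
    c₁ = α := by
  obtain ⟨m, hm, hmt⟩ := (csA n).exists_isReduced t
  have hnf := fc_nofork ht hm hmt.symm
  have key : ∀ (l m' : List (Fin (n + 1))) (c : ℕ), (csC n).IsReduced l → (csC n).wordProd l = w →
      Relation.ReflTransGen (RStep n) (l, 0) (m', c) → NoForkWord n m' →
      CommEquiv (CMat n) m' m ∧ c = α := by
    intro l m' c h1 h2 h3 h4
    have e := run_inv h3
    simp only [pow_zero, one_mul] at e
    rw [hchar l h1 h2 m hm hmt.symm] at e
    exact inj h4 hnf e.symm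
  obtain ⟨a1, a2⟩ := key l₁ m₁ c₁ hl₁ hw₁ hr₁ hm₁
  obtain ⟨b1, b2⟩ := key l₂ m₂ c₂ hl₂ hw₂ hr₂ hm₂
  refine ⟨Relation.ReflTransGen.trans a1 (ce_symm b1), a2.trans b2.symm,
    ce_red (ce_symm a1) hm, ?_, a2⟩
  rw [ce_prod a1, hmt]

end BCF
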